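/- Let V be a finite-dimensional complex vector space, let X ⊆ V be a nonempty subset closed under multiplication by nonzero scalars, and let p ∈ V be a nonzero vector with R_X(p) = 2. Then 3 ≤ R_{X × X}(p ⊗ p) ≤ 4, and R_{X × X}(p ⊗ p) = 3 if and only if there exists a 2-dimensional linear subspace L ⊆ V with p ∈ L such that X ∩ L contains at least 3 pairwise non-proportional nonzero vectors (i.e., p lies on a multisecant line to X). -/

import Mathlib

open scoped TensorProduct

noncomputable section

/-- `p` lies in the linear span of some `r` elements of `X`. -/
def HasRankLE {V : Type*} [AddCommGroup V] [Module ℂ V] (X : Set V) (p : V) (r : ℕ) : Prop :=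
  ∃ v : Fin r → V, (∀ i, v i ∈ X) ∧ p ∈ Submodule.span ℂ (Set.range v)

/-- The `X`-rank of `p`. -/
def xrank {V : Type*} [AddCommGroup V] [Module ℂ V] (X : Set V) (p : V) : ℕ :=
  sInf {r | HasRankLE X p r}

/-- The Segre product of two subsets. -/
def segre {V1 V2 : Type*} [AddCommGroup V1] [Module ℂ V1] [AddCommGroup V2] [Module ℂ V2]
    (X1 : Set V1) (X2 : Set V2) : Set (V1 ⊗[ℂ] V2) :=
  {t | ∃ x1 ∈ X1, ∃ x2 ∈ X2, t = x1 ⊗ₜ[ℂ] x2}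

section Rank

variable {V : Type*} [AddCommGroup V] [Module ℂ V]

lemma HasRankLE.mono {X : Set V} (hX : X.Nonempty) {p : V} {r s : ℕ} (hrs : r ≤ s)
    (h : HasRankLE X p r) : HasRankLE X p s := by
  induction s, hrs using Nat.le_induction with
  | base => exact h
  | succ s _ ih =>
    obtain ⟨v, hv, hp⟩ := ih
    obtain ⟨x, hx⟩ := hX
    refine ⟨Fin.cons x v, Fin.cases hx hv, ?_⟩
    rw [Fin.range_cons]
    exact Submodule.span_mono (Set.subset_insert _ _) hp

lemma xrank_le {X : Set V} {p : V} {r : ℕ} (h : HasRankLE X p r) : xrank X p ≤ r :=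
  Nat.sInf_le h

lemma hasRankLE_xrank {X : Set V} {p : V} (h : xrank X p ≠ 0) : HasRankLE X p (xrank X p) :=
  Nat.sInf_mem (Nat.nonempty_of_sInf_eq_succ (Nat.succ_pred h).symm)

lemma hasRankLE_two_iff {X : Set V} {p : V} :
    HasRankLE X p 2 ↔ ∃ x ∈ X, ∃ y ∈ X, ∃ a b : ℂ, p = a • x + b • y := by
  constructor
  · rintro ⟨v, hv, hp⟩
    obtain ⟨c, rfl⟩ := (Submodule.mem_span_range_iff_exists_fun ℂ).1 hp
    exact ⟨v 0, hv 0, v 1, hv 1, c 0, c 1, by simp [Fin.sum_univ_two]⟩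
  · rintro ⟨x, hx, y, hy, a, b, rfl⟩
    refine ⟨![x, y], by simp [Fin.forall_fin_two, hx, hy], ?_⟩
    exact (Submodule.mem_span_range_iff_exists_fun ℂ).2 ⟨![a, b], by simp [Fin.sum_univ_two]⟩

lemma hasRankLE_three_iff {X : Set V} {p : V} :
    HasRankLE X p 3 ↔
      ∃ x ∈ X, ∃ y ∈ X, ∃ z ∈ X, ∃ a b c : ℂ, p = a • x + b • y + c • z := by
  constructor
  · rintro ⟨v, hv, hp⟩
    obtain ⟨c, rfl⟩ := (Submodule.mem_span_range_iff_exists_fun ℂ).1 hp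
    exact ⟨v 0, hv 0, v 1, hv 1, v 2, hv 2, c 0, c 1, c 2, by simp [Fin.sum_univ_three]⟩
  · rintro ⟨x, hx, y, hy, z, hz, a, b, c, rfl⟩
    refine ⟨![x, y, z], by simp [Fin.forall_fin_succ, hx, hy, hz], ?_⟩
    exact (Submodule.mem_span_range_iff_exists_fun ℂ).2
      ⟨![a, b, c], by simp [Fin.sum_univ_three]⟩

lemma hasRankLE_four_segre {X : Set V} {x y : V} (hx : x ∈ X) (hy : y ∈ X) (a b : ℂ) :
    HasRankLE (segre X X) ((a • x + b • y) ⊗ₜ[ℂ] (a • x + b • y)) 4 := by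
  refine ⟨![x ⊗ₜ x, x ⊗ₜ y, y ⊗ₜ x, y ⊗ₜ y], ?_, ?_⟩
  · simp only [Fin.forall_fin_succ]
    exact ⟨⟨x, hx, x, hx, rfl⟩, ⟨x, hx, y, hy, rfl⟩, ⟨y, hy, x, hx, rfl⟩,
      ⟨y, hy, y, hy, rfl⟩, fun i => i.elim0⟩
  · refine (Submodule.mem_span_range_iff_exists_fun ℂ).2
      ⟨![a * a, a * b, b * a, b * b], ?_⟩
    simp only [Fin.sum_univ_four, TensorProduct.add_tmul, TensorProduct.tmul_add,
      TensorProduct.smul_tmul_smul]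
    simp
    abel

/-- Contracting a decomposition of `p ⊗ p` with a functional that kills the first left factor. -/
lemma exists_eq_of_tmul_self_eq {p a₁ a₂ a₃ b₁ b₂ b₃ : V} {c₁ c₂ c₃ : ℂ}
    (h : p ⊗ₜ[ℂ] p = c₁ • (a₁ ⊗ₜ b₁) + c₂ • (a₂ ⊗ₜ b₂) + c₃ • (a₃ ⊗ₜ b₃))
    (hp : p ∉ Submodule.span ℂ {a₁}) :
    ∃ s t : ℂ, p = (c₂ * s) • b₂ + (c₃ * t) • b₃ := by
  obtain ⟨f, hfp, hf⟩ := Submodule.exists_le_ker_of_notMem hp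
  have hfa : f a₁ = 0 := hf (Submodule.mem_span_singleton_self a₁)
  have key := congrArg ((TensorProduct.lid ℂ V).toLinearMap ∘ₗ f.rTensor V) h
  simp [hfa] at key
  refine ⟨(f p)⁻¹ * f a₂, (f p)⁻¹ * f a₃, ?_⟩
  exact ((eq_inv_smul_iff₀ hfp).2 key).trans (by module)

lemma ne_smul_of_eq_add {p x y : V} {a b : ℂ} (h : p = a • x + b • y)
    (hp : p ∉ Submodule.span ℂ {y}) (c : ℂ) : x ≠ c • y := by
  rintro rfl
  exact hp (Submodule.mem_span_singleton.2 ⟨a * c + b, by rw [h]; module⟩)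

lemma not_hasRankLE_two_segre_tmul_self {X : Set V} {p : V}
    (hp : ∀ x ∈ X, p ∉ Submodule.span ℂ {x}) :
    ¬ HasRankLE (segre X X) (p ⊗ₜ[ℂ] p) 2 := by
  rw [hasRankLE_two_iff]
  rintro ⟨_, ⟨a₁, ha₁, b₁, -, rfl⟩, _, ⟨a₂, -, b₂, hb₂, rfl⟩, c₁, c₂, h⟩
  obtain ⟨s, t, hst⟩ := exists_eq_of_tmul_self_eq
    (h.trans (by simp) : _ = c₁ • (a₁ ⊗ₜ b₁) + c₂ • (a₂ ⊗ₜ b₂) + (0 : ℂ) • (p ⊗ₜ p)) (hp a₁ ha₁)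
  exact hp b₂ hb₂ (Submodule.mem_span_singleton.2 ⟨c₂ * s, by simpa using hst.symm⟩)

lemma linearIndependent_pair_of_ne_smul {x y : V} (hy : y ≠ 0) (h : ∀ c : ℂ, x ≠ c • y) :
    LinearIndependent ℂ ![x, y] := by
  rw [LinearIndependent.pair_symm_iff, LinearIndependent.pair_iff' hy]
  exact fun c hc => h c hc.symm

lemma finrank_span_pair_of_ne_smul {x y : V} (hy : y ≠ 0) (h : ∀ c : ℂ, x ≠ c • y) :
    Module.finrank ℂ (Submodule.span ℂ {x, y}) = 2 := by
  have := finrank_span_eq_card (linearIndependent_pair_of_ne_smul hy h)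
  rwa [Matrix.range_cons_cons_empty, Fintype.card_fin] at this

/-- If `p ⊗ p` has rank at most three, then `p` lies on a multisecant line. -/
lemma exists_multisecant_of_hasRankLE_three {X : Set V} {p : V}
    (hp : ∀ x ∈ X, p ∉ Submodule.span ℂ {x}) (h : HasRankLE (segre X X) (p ⊗ₜ[ℂ] p) 3) :
    ∃ L : Submodule ℂ V, Module.finrank ℂ L = 2 ∧ p ∈ L ∧
      ∃ y1 y2 y3 : V,
        y1 ∈ X ∧ y1 ∈ L ∧ y2 ∈ X ∧ y2 ∈ L ∧ y3 ∈ X ∧ y3 ∈ L ∧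
        y1 ≠ 0 ∧ y2 ≠ 0 ∧ y3 ≠ 0 ∧
        (∀ c : ℂ, y1 ≠ c • y2) ∧ (∀ c : ℂ, y1 ≠ c • y3) ∧ (∀ c : ℂ, y2 ≠ c • y3) := by
  rw [hasRankLE_three_iff] at h
  obtain ⟨_, ⟨a₁, ha₁, b₁, hb₁, rfl⟩, _, ⟨a₂, ha₂, b₂, hb₂, rfl⟩, _, ⟨a₃, ha₃, b₃, hb₃, rfl⟩,
    c₁, c₂, c₃, h⟩ := h
  obtain ⟨s₁, t₁, h₁⟩ := exists_eq_of_tmul_self_eq h (hp a₁ ha₁)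
  obtain ⟨s₂, t₂, h₂⟩ := exists_eq_of_tmul_self_eq (h.trans (by abel) :
    _ = c₂ • (a₂ ⊗ₜ b₂) + c₁ • (a₁ ⊗ₜ b₁) + c₃ • (a₃ ⊗ₜ b₃)) (hp a₂ ha₂)
  obtain ⟨s₃, t₃, h₃⟩ := exists_eq_of_tmul_self_eq (h.trans (by abel) :
    _ = c₃ • (a₃ ⊗ₜ b₃) + c₁ • (a₁ ⊗ₜ b₁) + c₂ • (a₂ ⊗ₜ b₂)) (hp a₃ ha₃)
  have n₁₂ := ne_smul_of_eq_add h₃ (hp b₂ hb₂)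
  have n₁₃ := ne_smul_of_eq_add h₂ (hp b₃ hb₃)
  have n₂₃ := ne_smul_of_eq_add h₁ (hp b₃ hb₃)
  have n₃₂ := ne_smul_of_eq_add (h₁.trans (add_comm _ _)) (hp b₂ hb₂)
  have z₁ : b₁ ≠ 0 := by simpa using n₁₂ 0
  have z₂ : b₂ ≠ 0 := by simpa using n₂₃ 0
  have z₃ : b₃ ≠ 0 := by simpa using n₃₂ 0
  have m₁ : b₁ ∈ Submodule.span ℂ {b₁, b₂} := Submodule.subset_span (by simp)
  have m₂ : b₂ ∈ Submodule.span ℂ {b₁, b₂} := Submodule.subset_span (by simp)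
  have mp : p ∈ Submodule.span ℂ {b₁, b₂} :=
    h₃ ▸ Submodule.add_mem _ (Submodule.smul_mem _ _ m₁) (Submodule.smul_mem _ _ m₂)
  have ht : c₃ * t₁ ≠ 0 := fun h0 =>
    hp b₂ hb₂ (Submodule.mem_span_singleton.2 ⟨c₂ * s₁, by rw [h0] at h₁; simpa using h₁.symm⟩)
  have m₃ : b₃ ∈ Submodule.span ℂ {b₁, b₂} := by
    rw [← Submodule.smul_mem_iff _ ht, ← sub_eq_of_eq_add' h₁]
    exact Submodule.sub_mem _ mp (Submodule.smul_mem _ _ m₂)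
  exact ⟨_, finrank_span_pair_of_ne_smul z₂ n₁₂, mp, b₁, b₂, b₃, hb₁, m₁, hb₂, m₂, hb₃, m₃,
    z₁, z₂, z₃, n₁₂, n₁₃, n₂₃⟩

/-- If `p` lies on a multisecant line, then `p ⊗ p` is a combination of the squares of three
points of `X` on that line. -/
lemma hasRankLE_three_of_multisecant {X : Set V} {p y₁ y₂ y₃ : V} {L : Submodule ℂ V}
    (hL : Module.finrank ℂ L = 2) (hpL : p ∈ L)
    (hy₁ : y₁ ∈ X) (hl₁ : y₁ ∈ L) (hy₂ : y₂ ∈ X) (hl₂ : y₂ ∈ L) (hy₃ : y₃ ∈ X) (hl₃ : y₃ ∈ L)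
    (z₂ : y₂ ≠ 0) (z₃ : y₃ ≠ 0) (n₁₂ : ∀ c : ℂ, y₁ ≠ c • y₂)
    (n₁₃ : ∀ c : ℂ, y₁ ≠ c • y₃) (n₂₃ : ∀ c : ℂ, y₂ ≠ c • y₃) :
    HasRankLE (segre X X) (p ⊗ₜ[ℂ] p) 3 := by
  have : FiniteDimensional ℂ L := Module.finite_of_finrank_pos (by omega)
  have hspan : Submodule.span ℂ {y₁, y₂} = L :=
    Submodule.eq_of_le_of_finrank_eq
      (Submodule.span_le.2 (by rintro _ (rfl | rfl) <;> assumption))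
      ((finrank_span_pair_of_ne_smul z₂ n₁₂).trans hL.symm)
  rw [← hspan, Submodule.mem_span_pair] at hpL hl₃
  obtain ⟨s, t, rfl⟩ := hpL
  obtain ⟨a, b, rfl⟩ := hl₃
  have ha : a ≠ 0 := by
    rintro rfl
    have hb : b ≠ 0 := by rintro rfl; simp at z₃
    exact n₂₃ b⁻¹ (by simp [smul_smul, hb])
  have hb : b ≠ 0 := by
    rintro rfl
    exact n₁₃ a⁻¹ (by simp [smul_smul, ha])
  rw [hasRankLE_three_iff]
  refine ⟨_, ⟨y₁, hy₁, y₁, hy₁, rfl⟩, _, ⟨y₂, hy₂, y₂, hy₂, rfl⟩, _, ⟨_, hy₃, _, hy₃, rfl⟩,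
    s * s - s * t * a / b, t * t - s * t * b / a, s * t / (a * b), ?_⟩
  simp only [TensorProduct.add_tmul, TensorProduct.tmul_add, TensorProduct.smul_tmul_smul]
  match_scalars <;> field_simp <;> ring

end Rank

theorem stmt9 {V : Type*} [AddCommGroup V] [Module ℂ V] [FiniteDimensional ℂ V]
    (X : Set V) (hX : X.Nonempty)
    (hs : ∀ (c : ℂ), c ≠ 0 → ∀ x ∈ X, c • x ∈ X)
    (p : V) (hp : p ≠ 0) (hrank : xrank X p = 2) :
    (3 ≤ xrank (segre X X) (p ⊗ₜ[ℂ] p) ∧ xrank (segre X X) (p ⊗ₜ[ℂ] p) ≤ 4) ∧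
    (xrank (segre X X) (p ⊗ₜ[ℂ] p) = 3 ↔
      ∃ L : Submodule ℂ V, Module.finrank ℂ L = 2 ∧ p ∈ L ∧
        ∃ y1 y2 y3 : V,
          y1 ∈ X ∧ y1 ∈ L ∧ y2 ∈ X ∧ y2 ∈ L ∧ y3 ∈ X ∧ y3 ∈ L ∧
          y1 ≠ 0 ∧ y2 ≠ 0 ∧ y3 ≠ 0 ∧
          (∀ c : ℂ, y1 ≠ c • y2) ∧ (∀ c : ℂ, y1 ≠ c • y3) ∧ (∀ c : ℂ, y2 ≠ c • y3)) := by
  have hne : (segre X X).Nonempty := let ⟨x, hx⟩ := hX; ⟨_, x, hx, x, hx, rfl⟩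
  have hnot : ∀ x ∈ X, p ∉ Submodule.span ℂ {x} := fun x hx hpx => by
    have : xrank X p ≤ 1 := xrank_le ⟨fun _ => x, fun _ => hx, by simpa using hpx⟩
    omega
  have h4 : HasRankLE (segre X X) (p ⊗ₜ[ℂ] p) 4 := by
    have h2 : HasRankLE X p 2 := hrank ▸ hasRankLE_xrank (by omega)
    obtain ⟨x, hx, y, hy, a, b, rfl⟩ := hasRankLE_two_iff.1 h2
    exact hasRankLE_four_segre hx hy a b
  have hex : HasRankLE (segre X X) (p ⊗ₜ[ℂ] p) (xrank (segre X X) (p ⊗ₜ[ℂ] p)) :=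
    Nat.sInf_mem (s := {r | HasRankLE (segre X X) (p ⊗ₜ[ℂ] p) r}) ⟨4, h4⟩
  have hge : 3 ≤ xrank (segre X X) (p ⊗ₜ[ℂ] p) := by
    by_contra hlt
    exact not_hasRankLE_two_segre_tmul_self hnot (hex.mono hne (by omega))
  refine ⟨⟨hge, xrank_le h4⟩, fun h => exists_multisecant_of_hasRankLE_three hnot (h ▸ hex), ?_⟩
  rintro ⟨L, hL, hpL, y₁, y₂, y₃, hy₁, hl₁, hy₂, hl₂, hy₃, hl₃, -, z₂, z₃, n₁₂, n₁₃, n₂₃⟩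
  exact le_antisymm (xrank_le (hasRankLE_three_of_multisecant hL hpL hy₁ hl₁ hy₂ hl₂ hy₃ hl₃
    z₂ z₃ n₁₂ n₁₃ n₂₃)) hge
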